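/- There exist a real polynomial u and a real constant c > 0 such that the even Schwartz function f(x) = u(x²) e^{−x²/2} satisfies: (i) f(x) ≤ 0 for all x ≥ 3.9359; (ii) f̂(√(λ − 1/4)) ≥ c for all λ ∈ [0.71, 2.575]; (iii) f̂(√(λ − 1/4)) ≥ 0 for all λ ≥ 2.575; (iv) writing L₁ = 8·arccosh(1/2 + cos(2π/7)) and L₂ = 6·arccosh(8 cos⁴(π/7) − 6 cos²(π/7) + 1), one has (1/c) · ( 4 ∫₀^∞ ξ f̂(ξ) tanh(πξ) dξ + (1/√(2π)) ( 21·L₁·f(L₁)/sinh(L₁/2) + 28·L₂·f(L₂)/sinh(L₂/2) ) − (1/√(2π)) ∫_ℝ f(x) cosh(x/2) dx ) < 6. -/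

import Mathlib

open Real MeasureTheory

/-- The even function `x ↦ u(x²) e^{-x²/2}` associated to a real polynomial `u`. -/
noncomputable def gaussPoly (u : Polynomial ℝ) (x : ℝ) : ℝ :=
  u.eval (x ^ 2) * Real.exp (-x ^ 2 / 2)

/-- The Fourier transform `f̂(ξ) = (1/√(2π)) ∫_ℝ f(x) e^{-iξx} dx` of an even real-valued
function, written in its real form `(1/√(2π)) ∫_ℝ f(x) cos(ξ x) dx`. -/
noncomputable def evenFT (f : ℝ → ℝ) (ξ : ℝ) : ℝ :=
  (1 / Real.sqrt (2 * π)) * ∫ x : ℝ, f x * Real.cos (ξ * x)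

/-- The inverse of `cosh` mapping `[1, ∞)` to `[0, ∞)`, given by its standard
logarithmic formula. -/
noncomputable def Real.arccosh (x : ℝ) : ℝ :=
  Real.log (x + Real.sqrt (x ^ 2 - 1))

theorem integral_pow_mul_exp_neg_mul_Ioi (n : ℕ) {r : ℝ} (hr : 0 < r) :
    ∫ x in Set.Ioi (0 : ℝ), x ^ n * rexp (-(r * x)) = n.factorial / r ^ (n + 1) := by
  have h := Real.integral_rpow_mul_exp_neg_mul_Ioi (a := n + 1) (by positivity) hr
  rw [Real.Gamma_nat_eq_factorial, add_sub_cancel_right] at h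
  simp only [Real.rpow_natCast] at h
  rw [h, show (n : ℝ) + 1 = ((n + 1 : ℕ) : ℝ) by push_cast; ring, Real.rpow_natCast, one_div,
    inv_pow, inv_mul_eq_div]

theorem integrableOn_pow_mul_exp_neg_mul_Ioi (n : ℕ) {r : ℝ} (hr : 0 < r) :
    IntegrableOn (fun x : ℝ ↦ x ^ n * rexp (-(r * x))) (Set.Ioi 0) := by
  by_contra h
  have h0 := integral_pow_mul_exp_neg_mul_Ioi n hr
  rw [integral_undef h] at h0
  have : 0 < (n.factorial : ℝ) / r ^ (n + 1) := by positivity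
  exact this.ne h0

/-- The values of the Dirichlet eta function at positive even integers. -/
theorem hasSum_eta_two_mul {k : ℕ} (hk : k ≠ 0) :
    HasSum (fun m : ℕ ↦ (-1 : ℝ) ^ m / ((m : ℝ) + 1) ^ (2 * k))
      ((-1 : ℝ) ^ k * (2 * π) ^ (2 * k) / 2 / (2 * k).factorial *
        ((2 / 2 ^ (2 * k) - 1) * bernoulli (2 * k))) := by
  have h := hasSum_one_div_nat_pow_mul_cos hk (x := 2⁻¹) ⟨by norm_num, by norm_num⟩
  have hb : (Polynomial.map (algebraMap ℚ ℝ) (Polynomial.bernoulli (2 * k))).eval 2⁻¹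
      = (2 / 2 ^ (2 * k) - 1) * bernoulli (2 * k) := by
    rw [← bernoulliFun_eval_half]; rfl
  rw [hb, ← hasSum_nat_add_iff' 1] at h
  convert! h.neg using 1
  · funext m
    rw [show 2 * π * ((m + 1 : ℕ) : ℝ) * 2⁻¹ = (m + 1 : ℕ) * π by ring, Real.cos_nat_mul_pi]
    push_cast
    ring
  · simp only [Finset.sum_range_one, Nat.cast_zero]
    rw [zero_pow (by omega)]
    ring

theorem integral_pow_div_exp_add_one {k : ℕ} (hk : k ≠ 0) :
    ∫ x in Set.Ioi (0 : ℝ), x ^ (2 * k - 1) / (rexp (2 * π * x) + 1) =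
      (-1) ^ (k + 1) * (1 - 2 / 2 ^ (2 * k)) * bernoulli (2 * k) / (4 * k) := by
  have hpos (m : ℕ) : 0 < 2 * π * ((m : ℝ) + 1) := by positivity
  have hk1 : 2 * k - 1 + 1 = 2 * k := by omega
  set F : ℕ → ℝ → ℝ := fun m x ↦
    (-1) ^ m * (x ^ (2 * k - 1) * rexp (-(2 * π * ((m : ℝ) + 1) * x))) with hF
  have hFi (m : ℕ) : IntegrableOn (F m) (Set.Ioi 0) :=
    (integrableOn_pow_mul_exp_neg_mul_Ioi _ (hpos m)).const_mul _
  have hval (m : ℕ) : ∫ x in Set.Ioi (0 : ℝ), F m x =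
      (2 * k - 1).factorial / (2 * π) ^ (2 * k) * ((-1) ^ m / ((m : ℝ) + 1) ^ (2 * k)) := by
    rw [hF, integral_const_mul, integral_pow_mul_exp_neg_mul_Ioi _ (hpos m), hk1, mul_pow]
    field_simp
  have hnorm (m : ℕ) : ∫ x in Set.Ioi (0 : ℝ), ‖F m x‖ =
      (2 * k - 1).factorial / (2 * π) ^ (2 * k) * (1 / ((m : ℝ) + 1) ^ (2 * k)) := by
    have : ∀ x ∈ Set.Ioi (0 : ℝ), ‖F m x‖ =
        x ^ (2 * k - 1) * rexp (-(2 * π * ((m : ℝ) + 1) * x)) := by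
      intro x hx
      have hx : 0 < x := hx
      simp only [hF, norm_mul, norm_pow, norm_neg, norm_one, one_pow, one_mul, Real.norm_eq_abs,
        abs_of_pos hx, Real.abs_exp]
    rw [setIntegral_congr_fun measurableSet_Ioi this,
      integral_pow_mul_exp_neg_mul_Ioi _ (hpos m), hk1, mul_pow]
    field_simp
  have hsum : Summable fun m ↦ ∫ x in Set.Ioi (0 : ℝ), ‖F m x‖ := by
    simp_rw [hnorm]
    refine Summable.mul_left _ ?_
    have := (summable_nat_add_iff 1).2
      (Real.summable_one_div_nat_pow.2 (by omega : 1 < 2 * k))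
    simpa using this
  have hs := hasSum_integral_of_summable_integral_norm hFi hsum
  simp_rw [hval] at hs
  have hs' := (hasSum_eta_two_mul hk).mul_left
    (((2 * k - 1).factorial : ℝ) / (2 * π) ^ (2 * k))
  have hgeom : ∀ x ∈ Set.Ioi (0 : ℝ),
      ∑' m, F m x = x ^ (2 * k - 1) / (rexp (2 * π * x) + 1) := by
    intro x hx
    have hx : 0 < x := hx
    have hlt : ‖-rexp (-(2 * π * x))‖ < 1 := by
      rw [norm_neg, Real.norm_eq_abs, Real.abs_exp, Real.exp_lt_one_iff]
      have : 0 < 2 * π * x := by positivity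
      linarith
    have h1 := (hasSum_geometric_of_norm_lt_one hlt).mul_left
      (x ^ (2 * k - 1) * rexp (-(2 * π * x)))
    have h2 : HasSum (fun m ↦ F m x)
        (x ^ (2 * k - 1) * rexp (-(2 * π * x)) * (1 - -rexp (-(2 * π * x)))⁻¹) := by
      convert! h1 using 1
      funext m
      rw [hF, neg_pow, ← Real.exp_nat_mul]
      simp only
      rw [show -(2 * π * ((m : ℝ) + 1) * x) = -(2 * π * x) + m * -(2 * π * x) by ring,
        Real.exp_add]
      ring
    rw [h2.tsum_eq, Real.exp_neg]
    have := Real.exp_pos (2 * π * x)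
    rw [div_eq_mul_inv, mul_assoc]
    congr 1
    rw [← mul_inv, mul_sub, mul_neg, mul_inv_cancel₀ this.ne']
    ring
  rw [← setIntegral_congr_fun measurableSet_Ioi hgeom, hs.unique hs',
    ← Nat.mul_factorial_pred (by omega : 2 * k ≠ 0)]
  have : ((2 * k - 1).factorial : ℝ) ≠ 0 := by positivity
  have : (k : ℝ) ≠ 0 := by exact_mod_cast hk
  push_cast
  field_simp
  ring

theorem integrable_pow_mul_cexp_quadratic (n : ℕ) (z : ℂ) :
    Integrable fun x : ℝ ↦ (x : ℂ) ^ n * Complex.exp (-(1 / 2) * (x : ℂ) ^ 2 + z * x) := by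
  have hb : 0 < ((1 / 2 : ℂ)).re := by norm_num
  have h (c : ℂ) : Integrable fun x : ℝ ↦ Complex.exp (-(1 / 2) * (x : ℂ) ^ 2 + c * x) := by
    simpa using integrable_cexp_quadratic hb c 0
  refine (((h (z + 1)).norm.add (h (z - 1)).norm).const_mul (n.factorial : ℝ)).mono'
    (by fun_prop) (Filter.Eventually.of_forall fun x ↦ ?_)
  have h1 : Complex.exp (-(1 / 2) * (x : ℂ) ^ 2 + (z + 1) * x) =
      Complex.exp (-(1 / 2) * (x : ℂ) ^ 2 + z * x) * Complex.exp x := by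
    rw [← Complex.exp_add]; ring_nf
  have h2 : Complex.exp (-(1 / 2) * (x : ℂ) ^ 2 + (z - 1) * x) =
      Complex.exp (-(1 / 2) * (x : ℂ) ^ 2 + z * x) * Complex.exp (-x : ℝ) := by
    rw [← Complex.exp_add]; push_cast; ring_nf
  simp only [Pi.add_apply]
  rw [h1, h2, norm_mul, norm_mul, norm_mul, Complex.norm_exp_ofReal, Complex.norm_exp_ofReal,
    norm_pow, Complex.norm_real, Real.norm_eq_abs, ← mul_add, mul_comm, mul_left_comm]
  gcongr
  have h3 := Real.pow_div_factorial_le_exp |x| (abs_nonneg x) n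
  rw [div_le_iff₀ (by positivity)] at h3
  have h4 : rexp |x| ≤ rexp x + rexp (-x) := by
    rcases abs_choice x with h | h <;> rw [h] <;> linarith [Real.exp_pos x, Real.exp_pos (-x)]
  nlinarith [(by positivity : (0 : ℝ) < n.factorial)]

/-- The moments `∫ xⁿ e^{-x²/2 + zx} dx`. -/
noncomputable def gaussMoment (n : ℕ) (z : ℂ) : ℂ :=
  ∫ x : ℝ, (x : ℂ) ^ n * Complex.exp (-(1 / 2) * (x : ℂ) ^ 2 + z * x)

theorem hasDerivAt_cexp_quadratic (z : ℂ) (x : ℝ) :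
    HasDerivAt (fun x : ℝ ↦ Complex.exp (-(1 / 2) * (x : ℂ) ^ 2 + z * x))
      ((z - x) * Complex.exp (-(1 / 2) * (x : ℂ) ^ 2 + z * x)) x := by
  have h : HasDerivAt (fun w : ℂ ↦ Complex.exp (-(1 / 2) * w ^ 2 + z * w))
      ((z - x) * Complex.exp (-(1 / 2) * (x : ℂ) ^ 2 + z * x)) (x : ℂ) := by
    have h1 : HasDerivAt (fun w : ℂ ↦ -(1 / 2) * w ^ 2 + z * w) (z - x) (x : ℂ) := by
      convert! ((hasDerivAt_pow 2 (x : ℂ)).const_mul (-(1 / 2))).add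
        ((hasDerivAt_id (x : ℂ)).const_mul z) using 1
      push_cast
      ring
    convert! h1.cexp using 1
    ring
  exact h.comp_ofReal

theorem gaussMoment_one (z : ℂ) : gaussMoment 1 z = z * gaussMoment 0 z := by
  have hi := integrable_pow_mul_cexp_quadratic
  have h := integral_eq_zero_of_hasDerivAt_of_integrable (hasDerivAt_cexp_quadratic z)
    ((((hi 0 z).const_mul z).sub (hi 1 z)).congr (Filter.Eventually.of_forall fun x ↦ by
      simp only [Pi.sub_apply]; ring)) (by simpa using hi 0 z)
  have h' : ∫ x : ℝ, (z * ((x : ℂ) ^ 0 * Complex.exp (-(1 / 2) * (x : ℂ) ^ 2 + z * x)) -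
      (x : ℂ) ^ 1 * Complex.exp (-(1 / 2) * (x : ℂ) ^ 2 + z * x)) = 0 := by
    rw [← h]; congr 1; funext x; ring
  rw [integral_sub ((hi 0 z).const_mul z) (hi 1 z), integral_const_mul] at h'
  exact (sub_eq_zero.1 h').symm

theorem gaussMoment_add_two (n : ℕ) (z : ℂ) :
    gaussMoment (n + 2) z = z * gaussMoment (n + 1) z + (n + 1) * gaussMoment n z := by
  have hi := integrable_pow_mul_cexp_quadratic
  have hd (x : ℝ) : HasDerivAt
      (fun x : ℝ ↦ (x : ℂ) ^ (n + 1) * Complex.exp (-(1 / 2) * (x : ℂ) ^ 2 + z * x))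
      (z * ((x : ℂ) ^ (n + 1) * Complex.exp (-(1 / 2) * (x : ℂ) ^ 2 + z * x)) +
        (n + 1) * ((x : ℂ) ^ n * Complex.exp (-(1 / 2) * (x : ℂ) ^ 2 + z * x)) -
        (x : ℂ) ^ (n + 2) * Complex.exp (-(1 / 2) * (x : ℂ) ^ 2 + z * x)) x := by
    convert! ((hasDerivAt_pow (n + 1) (x : ℂ)).comp_ofReal).mul
      (hasDerivAt_cexp_quadratic z x) using 1
    push_cast
    ring
  have h := integral_eq_zero_of_hasDerivAt_of_integrable hd
    ((((hi _ z).const_mul z).add ((hi _ z).const_mul _)).sub (hi _ z)) (hi _ z)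
  have hadd : Integrable fun x : ℝ ↦
      z * ((x : ℂ) ^ (n + 1) * Complex.exp (-(1 / 2) * (x : ℂ) ^ 2 + z * x)) +
        (n + 1) * ((x : ℂ) ^ n * Complex.exp (-(1 / 2) * (x : ℂ) ^ 2 + z * x)) :=
    ((hi _ z).const_mul z).add ((hi _ z).const_mul _)
  rw [integral_sub hadd (hi _ z), integral_add ((hi _ z).const_mul z) ((hi _ z).const_mul _),
    integral_const_mul, integral_const_mul] at h
  exact (sub_eq_zero.1 h).symm

theorem gaussMoment_zero (z : ℂ) :
    gaussMoment 0 z = (Real.sqrt (2 * π) : ℂ) * Complex.exp (z ^ 2 / 2) := by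
  have h := integral_cexp_quadratic (b := -(1 / 2)) (by norm_num) z 0
  simp only [add_zero] at h
  simp only [gaussMoment, pow_zero, one_mul, h]
  rw [Real.sqrt_eq_rpow, Complex.ofReal_cpow (by positivity)]
  push_cast
  congr 2 <;> ring_nf

/-- The values `E_k(w)` with `∫ x^{2k} e^{-x²/2 + zx} dx = √(2π) e^{z²/2} E_k(z²)`. -/
def evenHermite {R : Type*} [CommRing R] (w : R) : ℕ → R
  | 0 => 1
  | 1 => w + 1
  | k + 2 => (w + 4 * k + 5) * evenHermite w (k + 1) - (2 * k + 1) * (2 * k + 2) * evenHermite w k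

theorem evenHermite_ofReal (w : ℝ) : ∀ k, evenHermite (w : ℂ) k = (evenHermite w k : ℝ)
  | 0 => by simp [evenHermite]
  | 1 => by simp [evenHermite]
  | k + 2 => by
    simp only [evenHermite, evenHermite_ofReal w k, evenHermite_ofReal w (k + 1)]
    push_cast
    ring

theorem gaussMoment_two_mul (z : ℂ) : ∀ k, gaussMoment (2 * k) z =
    (Real.sqrt (2 * π) : ℂ) * Complex.exp (z ^ 2 / 2) * evenHermite (z ^ 2) k
  | 0 => by simp [evenHermite, gaussMoment_zero]
  | 1 => by
    rw [mul_one, gaussMoment_add_two, zero_add, gaussMoment_one, gaussMoment_zero]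
    simp only [evenHermite]
    push_cast
    ring
  | k + 2 => by
    have h0 := gaussMoment_two_mul z k
    have h1 := gaussMoment_two_mul z (k + 1)
    have r2 := gaussMoment_add_two (2 * k) z
    have r3 := gaussMoment_add_two (2 * k + 1) z
    have r4 := gaussMoment_add_two (2 * k + 2) z
    simp only [evenHermite, show 2 * (k + 2) = 2 * k + 2 + 2 by ring,
      show 2 * (k + 1) = 2 * k + 2 by ring] at *
    push_cast at *
    linear_combination r4 + z * r3 - (2 * k + 2) * r2 + (z ^ 2 + 4 * k + 5) * h1 -
      (2 * k + 1) * (2 * k + 2) * h0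

theorem integral_pow_mul_gaussian_mul_cos (k : ℕ) (ξ : ℝ) :
    ∫ x : ℝ, (x ^ 2) ^ k * rexp (-x ^ 2 / 2) * Real.cos (ξ * x) =
      Real.sqrt (2 * π) * rexp (-ξ ^ 2 / 2) * evenHermite (-ξ ^ 2) k := by
  have h := gaussMoment_two_mul (ξ * Complex.I) k
  have hz : (ξ * Complex.I : ℂ) ^ 2 = ((-ξ ^ 2 : ℝ) : ℂ) := by
    rw [mul_pow, Complex.I_sq]; push_cast; ring
  rw [hz, evenHermite_ofReal, show (((-ξ ^ 2 : ℝ) : ℂ) / 2) = ((-ξ ^ 2 / 2 : ℝ) : ℂ) by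
    push_cast; ring, ← Complex.ofReal_exp, ← Complex.ofReal_mul, ← Complex.ofReal_mul] at h
  have h' := congrArg Complex.re h
  rw [Complex.ofReal_re] at h'
  rw [← h', gaussMoment, ← RCLike.re_eq_complex_re, ← integral_re
    (integrable_pow_mul_cexp_quadratic _ _)]
  congr 1
  funext x
  rw [show (-(1 / 2) * (x : ℂ) ^ 2 + ξ * Complex.I * x) =
    ((-x ^ 2 / 2 : ℝ) : ℂ) + ((ξ * x : ℝ) : ℂ) * Complex.I by push_cast; ring, Complex.exp_add,
    ← Complex.ofReal_exp, ← Complex.ofReal_pow, RCLike.re_eq_complex_re, Complex.re_ofReal_mul,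
    Complex.re_ofReal_mul, Complex.exp_ofReal_mul_I_re, pow_mul]
  ring

theorem integrable_pow_mul_gaussian_mul_exp (n : ℕ) (a : ℝ) :
    Integrable fun x : ℝ ↦ x ^ n * rexp (-x ^ 2 / 2) * rexp (a * x) := by
  refine (integrable_pow_mul_cexp_quadratic n a).norm.mono (by fun_prop)
    (Filter.Eventually.of_forall fun x ↦ le_of_eq ?_)
  rw [show (-(1 / 2) * (x : ℂ) ^ 2 + a * x) = ((-x ^ 2 / 2 + a * x : ℝ) : ℂ) by push_cast; ring,
    norm_norm, ← Complex.ofReal_exp, ← Complex.ofReal_pow, ← Complex.ofReal_mul,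
    Complex.norm_real, mul_assoc, ← Real.exp_add]

theorem integral_pow_mul_gaussian_mul_exp (k : ℕ) (a : ℝ) :
    ∫ x : ℝ, x ^ (2 * k) * rexp (-x ^ 2 / 2) * rexp (a * x) =
      Real.sqrt (2 * π) * rexp (a ^ 2 / 2) * evenHermite (a ^ 2) k := by
  have h := gaussMoment_two_mul a k
  rw [← Complex.ofReal_pow, evenHermite_ofReal, show (((a ^ 2 : ℝ) : ℂ) / 2) =
    ((a ^ 2 / 2 : ℝ) : ℂ) by push_cast; ring, ← Complex.ofReal_exp, ← Complex.ofReal_mul,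
    ← Complex.ofReal_mul] at h
  rw [← Complex.ofReal_inj, ← h, gaussMoment, ← integral_complex_ofReal]
  congr 1
  funext x
  push_cast
  rw [mul_assoc, ← Complex.exp_add]
  ring_nf

theorem integral_pow_mul_gaussian_mul_cosh (k : ℕ) (a : ℝ) :
    ∫ x : ℝ, (x ^ 2) ^ k * rexp (-x ^ 2 / 2) * Real.cosh (a * x) =
      Real.sqrt (2 * π) * rexp (a ^ 2 / 2) * evenHermite (a ^ 2) k := by
  have h1 := integral_pow_mul_gaussian_mul_exp k a
  have h2 := integral_pow_mul_gaussian_mul_exp k (-a)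
  rw [neg_sq] at h2
  have h3 := integral_add (integrable_pow_mul_gaussian_mul_exp (2 * k) a)
    (integrable_pow_mul_gaussian_mul_exp (2 * k) (-a))
  rw [h1, h2] at h3
  have h4 : (fun x : ℝ ↦ (x ^ 2) ^ k * rexp (-x ^ 2 / 2) * Real.cosh (a * x)) = fun x ↦
      2⁻¹ * (x ^ (2 * k) * rexp (-x ^ 2 / 2) * rexp (a * x) +
        x ^ (2 * k) * rexp (-x ^ 2 / 2) * rexp (-a * x)) := by
    funext x
    rw [Real.cosh_eq, pow_mul, neg_mul]
    ring
  rw [h4, integral_const_mul, h3]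
  ring

theorem integrable_pow_mul_gaussian_mul_cos (k : ℕ) (ξ : ℝ) :
    Integrable fun x : ℝ ↦ (x ^ 2) ^ k * rexp (-x ^ 2 / 2) * Real.cos (ξ * x) := by
  have h := integrable_pow_mul_gaussian_mul_exp (2 * k) 0
  simp only [zero_mul, Real.exp_zero, mul_one, pow_mul] at h
  refine h.mono (by fun_prop) (Filter.Eventually.of_forall fun x ↦ ?_)
  rw [norm_mul]
  exact mul_le_of_le_one_right (norm_nonneg _) (Real.abs_cos_le_one _)

theorem integrable_pow_mul_gaussian_mul_cosh (k : ℕ) (a : ℝ) :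
    Integrable fun x : ℝ ↦ (x ^ 2) ^ k * rexp (-x ^ 2 / 2) * Real.cosh (a * x) := by
  refine (((integrable_pow_mul_gaussian_mul_exp (2 * k) a).add
    (integrable_pow_mul_gaussian_mul_exp (2 * k) (-a))).const_mul 2⁻¹).congr
    (Filter.Eventually.of_forall fun x ↦ ?_)
  simp only [Pi.add_apply]
  rw [Real.cosh_eq, pow_mul, neg_mul]
  ring

/-- The polynomial `∑_{k<n} aₖ Xᵏ`. -/
noncomputable def polyOfCoeffs (n : ℕ) (a : ℕ → ℝ) : Polynomial ℝ :=
  ∑ k ∈ Finset.range n, Polynomial.C (a k) * Polynomial.X ^ k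

theorem eval_polyOfCoeffs (n : ℕ) (a : ℕ → ℝ) (t : ℝ) :
    (polyOfCoeffs n a).eval t = ∑ k ∈ Finset.range n, a k * t ^ k := by
  simp [polyOfCoeffs, Polynomial.eval_finsetSum]

theorem evenFT_gaussPoly (n : ℕ) (a : ℕ → ℝ) (ξ : ℝ) :
    evenFT (gaussPoly (polyOfCoeffs n a)) ξ =
      (∑ k ∈ Finset.range n, a k * evenHermite (-ξ ^ 2) k) * rexp (-ξ ^ 2 / 2) := by
  have h : (fun x ↦ gaussPoly (polyOfCoeffs n a) x * Real.cos (ξ * x)) = fun x ↦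
      ∑ k ∈ Finset.range n, a k * ((x ^ 2) ^ k * rexp (-x ^ 2 / 2) * Real.cos (ξ * x)) := by
    funext x
    rw [gaussPoly, eval_polyOfCoeffs, Finset.sum_mul, Finset.sum_mul]
    exact Finset.sum_congr rfl fun k _ ↦ by ring
  rw [evenFT, h, integral_finsetSum _ fun k _ ↦
    (integrable_pow_mul_gaussian_mul_cos k ξ).const_mul _]
  simp_rw [integral_const_mul, integral_pow_mul_gaussian_mul_cos]
  rw [Finset.mul_sum, Finset.sum_mul]
  refine Finset.sum_congr rfl fun k _ ↦ ?_
  have : 0 < Real.sqrt (2 * π) := by positivity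
  field_simp

theorem integral_gaussPoly_mul_cosh (n : ℕ) (a : ℕ → ℝ) (c : ℝ) :
    (1 / Real.sqrt (2 * π)) * ∫ x, gaussPoly (polyOfCoeffs n a) x * Real.cosh (c * x) =
      (∑ k ∈ Finset.range n, a k * evenHermite (c ^ 2) k) * rexp (c ^ 2 / 2) := by
  have h : (fun x ↦ gaussPoly (polyOfCoeffs n a) x * Real.cosh (c * x)) = fun x ↦
      ∑ k ∈ Finset.range n, a k * ((x ^ 2) ^ k * rexp (-x ^ 2 / 2) * Real.cosh (c * x)) := by
    funext x
    rw [gaussPoly, eval_polyOfCoeffs, Finset.sum_mul, Finset.sum_mul]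
    exact Finset.sum_congr rfl fun k _ ↦ by ring
  rw [h, integral_finsetSum _ fun k _ ↦
    (integrable_pow_mul_gaussian_mul_cosh k c).const_mul _]
  simp_rw [integral_const_mul, integral_pow_mul_gaussian_mul_cosh]
  rw [Finset.mul_sum, Finset.sum_mul]
  refine Finset.sum_congr rfl fun k _ ↦ ?_
  have : 0 < Real.sqrt (2 * π) := by positivity
  field_simp

theorem integral_odd_pow_mul_gaussian (k : ℕ) :
    ∫ x in Set.Ioi (0 : ℝ), x * ((x ^ 2) ^ k * rexp (-x ^ 2 / 2)) = 2 ^ k * k.factorial := by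
  have h := integral_rpow_mul_exp_neg_mul_rpow (p := 2) (q := (2 * k + 1 : ℕ)) (b := 1 / 2)
    (by norm_num) (by push_cast; linarith [(Nat.cast_nonneg k : (0 : ℝ) ≤ k)]) (by norm_num)
  have e : (((2 * k + 1 : ℕ) : ℝ) + 1) / 2 = k + 1 := by push_cast; ring
  rw [neg_div, e, Real.Gamma_nat_eq_factorial, one_div, Real.inv_rpow (by norm_num),
    Real.rpow_neg (by norm_num), inv_inv, show (k : ℝ) + 1 = ((k + 1 : ℕ) : ℝ) by push_cast; ring,
    Real.rpow_natCast] at h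
  calc _ = ∫ x in Set.Ioi (0 : ℝ), x ^ ((2 * k + 1 : ℕ) : ℝ) * rexp (-2⁻¹ * x ^ (2 : ℝ)) := by
        congr 1
        funext x
        rw [Real.rpow_natCast, Real.rpow_two, pow_succ x (2 * k), pow_mul]
        ring_nf
    _ = _ := by rw [h, pow_succ]; ring

theorem integrableOn_odd_pow_mul_gaussian (k : ℕ) :
    IntegrableOn (fun x : ℝ ↦ x * ((x ^ 2) ^ k * rexp (-x ^ 2 / 2))) (Set.Ioi 0) := by
  have h := integrable_pow_mul_gaussian_mul_exp (2 * k + 1) 0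
  refine (h.congr (Filter.Eventually.of_forall fun x ↦ ?_)).integrableOn
  simp only [zero_mul, Real.exp_zero, mul_one, pow_succ, pow_mul]
  ring

theorem integrableOn_odd_pow_div_exp_add_one (k : ℕ) :
    IntegrableOn (fun x : ℝ ↦ x * ((x ^ 2) ^ k / (rexp (2 * π * x) + 1))) (Set.Ioi 0) := by
  refine Integrable.mono (integrableOn_pow_mul_exp_neg_mul_Ioi (2 * k + 1)
    (by positivity : 0 < 2 * π)) (Measurable.aestronglyMeasurable (by fun_prop)) ?_
  refine (ae_restrict_iff' measurableSet_Ioi).2 (Filter.Eventually.of_forall fun x hx ↦ ?_)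
  have hx : 0 < x := hx
  rw [Real.norm_of_nonneg (by positivity), Real.norm_of_nonneg (by positivity), Real.exp_neg,
    pow_succ x (2 * k), pow_mul, mul_comm (_ ^ k) x, ← div_eq_mul_inv,
    mul_div_assoc]
  refine mul_le_mul_of_nonneg_left (div_le_div_of_nonneg_left ?_ ?_ ?_) hx.le
  · positivity
  · positivity
  · linarith

theorem integral_odd_pow_div_exp_add_one (k : ℕ) :
    ∫ x in Set.Ioi (0 : ℝ), x * ((x ^ 2) ^ k / (rexp (2 * π * x) + 1)) =
      (-1) ^ k * (1 - 2 / 2 ^ (2 * k + 2)) * ((bernoulli (2 * k + 2) : ℚ) : ℝ) / (4 * k + 4) := by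
  have h := integral_pow_div_exp_add_one (k := k + 1) (by omega)
  rw [show 2 * (k + 1) - 1 = 2 * k + 1 by omega, show 2 * (k + 1) = 2 * k + 2 by ring] at h
  simp_rw [← mul_div_assoc, ← pow_mul, ← pow_succ', h]
  push_cast
  ring

theorem sum_mul_tanh_integral_le (n m : ℕ) (b d : ℕ → ℝ)
    (hbd : ∀ t, 0 ≤ t → ∑ k ∈ Finset.range m, d k * t ^ k ≤
      (∑ k ∈ Finset.range n, b k * t ^ k) * rexp (-t / 2)) :
    ∫ x in Set.Ioi (0 : ℝ), x * ((∑ k ∈ Finset.range n, b k * (x ^ 2) ^ k) * rexp (-x ^ 2 / 2)) *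
        Real.tanh (π * x) ≤
      ∑ k ∈ Finset.range n, b k * (2 ^ k * k.factorial) - 2 * ∑ k ∈ Finset.range m, d k *
        ((-1) ^ k * (1 - 2 / 2 ^ (2 * k + 2)) * ((bernoulli (2 * k + 2) : ℚ) : ℝ) / (4 * k + 4)) := by
  have i1 : IntegrableOn (fun x : ℝ ↦
      ∑ k ∈ Finset.range n, b k * (x * ((x ^ 2) ^ k * rexp (-x ^ 2 / 2)))) (Set.Ioi 0) :=
    integrable_finsetSum _ fun k _ ↦ (integrableOn_odd_pow_mul_gaussian k).const_mul _
  have i2 : IntegrableOn (fun x : ℝ ↦ 2 *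
      ∑ k ∈ Finset.range m, d k * (x * ((x ^ 2) ^ k / (rexp (2 * π * x) + 1)))) (Set.Ioi 0) :=
    (integrable_finsetSum _ fun k _ ↦
      (integrableOn_odd_pow_div_exp_add_one k).const_mul _).const_mul 2
  have hexp (x : ℝ) : x * ((∑ k ∈ Finset.range n, b k * (x ^ 2) ^ k) * rexp (-x ^ 2 / 2)) =
      ∑ k ∈ Finset.range n, b k * (x * ((x ^ 2) ^ k * rexp (-x ^ 2 / 2))) := by
    rw [Finset.sum_mul, Finset.mul_sum]
    exact Finset.sum_congr rfl fun k _ ↦ by ring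
  have hle : ∀ x ∈ Set.Ioi (0 : ℝ),
      x * ((∑ k ∈ Finset.range n, b k * (x ^ 2) ^ k) * rexp (-x ^ 2 / 2)) * Real.tanh (π * x) ≤
      ∑ k ∈ Finset.range n, b k * (x * ((x ^ 2) ^ k * rexp (-x ^ 2 / 2))) - 2 *
        ∑ k ∈ Finset.range m, d k * (x * ((x ^ 2) ^ k / (rexp (2 * π * x) + 1))) := by
    intro x hx
    have hx : 0 < x := hx
    have ht : Real.tanh (π * x) = 1 - 2 / (rexp (2 * π * x) + 1) := by
      rw [Real.tanh_eq, Real.exp_neg, show 2 * π * x = π * x + π * x by ring, Real.exp_add]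
      have := Real.exp_pos (π * x)
      field_simp
      ring
    have hsum : ∑ k ∈ Finset.range m, d k * (x * ((x ^ 2) ^ k / (rexp (2 * π * x) + 1))) =
        x * (∑ k ∈ Finset.range m, d k * (x ^ 2) ^ k) / (rexp (2 * π * x) + 1) := by
      rw [Finset.mul_sum, Finset.sum_div]
      exact Finset.sum_congr rfl fun k _ ↦ by ring
    rw [← hexp, ht, hsum]
    have h := hbd (x ^ 2) (sq_nonneg x)
    have h' : x * (∑ k ∈ Finset.range m, d k * (x ^ 2) ^ k) / (rexp (2 * π * x) + 1) ≤
        x * ((∑ k ∈ Finset.range n, b k * (x ^ 2) ^ k) * rexp (-x ^ 2 / 2)) /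
          (rexp (2 * π * x) + 1) := by gcongr
    rw [mul_sub, mul_one, mul_div_assoc', mul_comm _ (2 : ℝ), mul_div_assoc]
    linarith
  have i0 : IntegrableOn (fun x : ℝ ↦
      x * ((∑ k ∈ Finset.range n, b k * (x ^ 2) ^ k) * rexp (-x ^ 2 / 2)) * Real.tanh (π * x))
      (Set.Ioi 0) := by
    simp_rw [hexp]
    have hc : Continuous Real.tanh := by
      simp_rw [funext Real.tanh_eq_sinh_div_cosh]
      exact Real.continuous_sinh.div Real.continuous_cosh fun x ↦ (Real.cosh_pos x).ne'
    refine Integrable.mono i1 (by fun_prop) (Filter.Eventually.of_forall fun x ↦ ?_)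
    rw [norm_mul]
    exact mul_le_of_le_one_right (norm_nonneg _) (Real.abs_tanh_lt_one _).le
  refine (setIntegral_mono_on i0 (i1.sub i2) measurableSet_Ioi hle).trans_eq ?_
  simp only [Pi.sub_apply]
  rw [integral_sub i1 i2, integral_const_mul, integral_finsetSum _ fun k _ ↦
      (integrableOn_odd_pow_mul_gaussian k).const_mul _, integral_finsetSum _ fun k _ ↦
      (integrableOn_odd_pow_div_exp_add_one k).const_mul _]
  simp_rw [integral_const_mul, integral_odd_pow_mul_gaussian, integral_odd_pow_div_exp_add_one]

theorem bernoulli_two_mul_values :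
    bernoulli 2 = 1/6 ∧
    bernoulli 4 = -1/30 ∧
    bernoulli 6 = 1/42 ∧
    bernoulli 8 = -1/30 ∧
    bernoulli 10 = 5/66 ∧
    bernoulli 12 = -691/2730 ∧
    bernoulli 14 = 7/6 ∧
    bernoulli 16 = -3617/510 ∧
    bernoulli 18 = 43867/798 ∧
    bernoulli 20 = -174611/330 ∧
    bernoulli 22 = 854513/138 ∧
    bernoulli 24 = -236364091/2730 ∧
    bernoulli 26 = 8553103/6 ∧
    bernoulli 28 = -23749461029/870 ∧
    bernoulli 30 = 8615841276005/14322 ∧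
    bernoulli 32 = -7709321041217/510 ∧
    bernoulli 34 = 2577687858367/6 := by
  have b0 := bernoulli_zero
  have b1 := bernoulli_one
  have b3 : bernoulli 3 = 0 := bernoulli_eq_zero_of_odd (by decide) (by norm_num)
  have b5 : bernoulli 5 = 0 := bernoulli_eq_zero_of_odd (by decide) (by norm_num)
  have b7 : bernoulli 7 = 0 := bernoulli_eq_zero_of_odd (by decide) (by norm_num)
  have b9 : bernoulli 9 = 0 := bernoulli_eq_zero_of_odd (by decide) (by norm_num)
  have b11 : bernoulli 11 = 0 := bernoulli_eq_zero_of_odd (by decide) (by norm_num)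
  have b13 : bernoulli 13 = 0 := bernoulli_eq_zero_of_odd (by decide) (by norm_num)
  have b15 : bernoulli 15 = 0 := bernoulli_eq_zero_of_odd (by decide) (by norm_num)
  have b17 : bernoulli 17 = 0 := bernoulli_eq_zero_of_odd (by decide) (by norm_num)
  have b19 : bernoulli 19 = 0 := bernoulli_eq_zero_of_odd (by decide) (by norm_num)
  have b21 : bernoulli 21 = 0 := bernoulli_eq_zero_of_odd (by decide) (by norm_num)
  have b23 : bernoulli 23 = 0 := bernoulli_eq_zero_of_odd (by decide) (by norm_num)
  have b25 : bernoulli 25 = 0 := bernoulli_eq_zero_of_odd (by decide) (by norm_num)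
  have b27 : bernoulli 27 = 0 := bernoulli_eq_zero_of_odd (by decide) (by norm_num)
  have b29 : bernoulli 29 = 0 := bernoulli_eq_zero_of_odd (by decide) (by norm_num)
  have b31 : bernoulli 31 = 0 := bernoulli_eq_zero_of_odd (by decide) (by norm_num)
  have b33 : bernoulli 33 = 0 := bernoulli_eq_zero_of_odd (by decide) (by norm_num)
  have b2 : bernoulli 2 = 1 / 6 := by rw [bernoulli_two, one_div]
  have b4 : bernoulli 4 = -1/30 := by
    have h := sum_bernoulli 5
    norm_num [Finset.sum_range_succ, Nat.choose, *] at h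
    linarith
  have b6 : bernoulli 6 = 1/42 := by
    have h := sum_bernoulli 7
    norm_num [Finset.sum_range_succ, Nat.choose, *] at h
    linarith
  have b8 : bernoulli 8 = -1/30 := by
    have h := sum_bernoulli 9
    norm_num [Finset.sum_range_succ, Nat.choose, *] at h
    linarith
  have b10 : bernoulli 10 = 5/66 := by
    have h := sum_bernoulli 11
    norm_num [Finset.sum_range_succ, Nat.choose, *] at h
    linarith
  have b12 : bernoulli 12 = -691/2730 := by
    have h := sum_bernoulli 13
    norm_num [Finset.sum_range_succ, Nat.choose, *] at h
    linarith
  have b14 : bernoulli 14 = 7/6 := by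
    have h := sum_bernoulli 15
    norm_num [Finset.sum_range_succ, Nat.choose, *] at h
    linarith
  have b16 : bernoulli 16 = -3617/510 := by
    have h := sum_bernoulli 17
    norm_num [Finset.sum_range_succ, Nat.choose, *] at h
    linarith
  have b18 : bernoulli 18 = 43867/798 := by
    have h := sum_bernoulli 19
    norm_num [Finset.sum_range_succ, Nat.choose, *] at h
    linarith
  have b20 : bernoulli 20 = -174611/330 := by
    have h := sum_bernoulli 21
    norm_num [Finset.sum_range_succ, Nat.choose, *] at h
    linarith
  have b22 : bernoulli 22 = 854513/138 := by
    have h := sum_bernoulli 23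
    norm_num [Finset.sum_range_succ, Nat.choose, *] at h
    linarith
  have b24 : bernoulli 24 = -236364091/2730 := by
    have h := sum_bernoulli 25
    norm_num [Finset.sum_range_succ, Nat.choose, *] at h
    linarith
  have b26 : bernoulli 26 = 8553103/6 := by
    have h := sum_bernoulli 27
    norm_num [Finset.sum_range_succ, Nat.choose, *] at h
    linarith
  have b28 : bernoulli 28 = -23749461029/870 := by
    have h := sum_bernoulli 29
    norm_num [Finset.sum_range_succ, Nat.choose, *] at h
    linarith
  have b30 : bernoulli 30 = 8615841276005/14322 := by
    have h := sum_bernoulli 31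
    norm_num [Finset.sum_range_succ, Nat.choose, *] at h
    linarith
  have b32 : bernoulli 32 = -7709321041217/510 := by
    have h := sum_bernoulli 33
    norm_num [Finset.sum_range_succ, Nat.choose, *] at h
    linarith
  have b34 : bernoulli 34 = 2577687858367/6 := by
    have h := sum_bernoulli 35
    norm_num [Finset.sum_range_succ, Nat.choose, *] at h
    linarith
  exact ⟨b2, b4, b6, b8, b10, b12, b14, b16, b18, b20, b22, b24, b26, b28, b30, b32,
    b34⟩

/-- The polynomial `v` with `f̂(ξ) = v(ξ²) e^{-ξ²/2}` for the test function `f`. -/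
noncomputable def kleinTransform (t : ℝ) : ℝ :=
  (3 - t) ^ 2 * (7 - t) ^ 2 * (12 - t) ^ 2 * (21 - t) ^ 2 * (32 - t) ^ 2 * (53 - t) ^ 2 *
    (500 * t + 451)

/-- The coefficients of `kleinTransform`. -/
noncomputable def kleinTransformCoeff (k : ℕ) : ℝ :=
  ([36330210043674624, -7479449776253952, -26718012576125136, 21122666375755896,
    -7329064251896613, 1469140822352844, -187028626264532, 15785866167736, -899083518438,
    34530494784, -876748308, 14030544, -127549, 500] :
    List ℝ).getD k 0

/-- The coefficients of the polynomial `u` with `f(x) = u(x²) e^{-x²/2}`. -/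
noncomputable def kleinCoeff (k : ℕ) : ℝ :=
  ([23315006010878064, 7756427946976128, 1299423551850144, 115151511218688, 13295531633832,
    -750822981120, 206138907104, -30008054416, 3352995519, -354263784, 25025334, -1252020, 34951,
    -500] :
    List ℝ).getD k 0

/-- The coefficients of `kleinTransform` times the cubic Taylor polynomial of `e^{-t/2}`.
They are listed with the common denominator `48`. -/
noncomputable def kleinTruncCoeff (k : ℕ) : ℝ :=
  ([1743850082096381952, -1230938630308380672, -884976548761863936, 1573913379162087936,
    -1011567702789675792, 399870312349115736, -109333805684301366, 21390317792413773,
    -3013329376850724, 304979291463092, -22051183071964, 1127981912646, -40133840040, 964016748,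
    -14807838, 130549, -500] :
    List ℝ).getD k 0 / 48

theorem sum_kleinTransformCoeff (t : ℝ) :
    ∑ k ∈ Finset.range 14, kleinTransformCoeff k * t ^ k = kleinTransform t := by
  simp only [Finset.sum_range_succ, Finset.sum_range_zero, kleinTransformCoeff,
    List.getD_cons_zero, List.getD_cons_succ, kleinTransform]
  ring

theorem sum_kleinTruncCoeff (t : ℝ) : ∑ k ∈ Finset.range 17, kleinTruncCoeff k * t ^ k =
    kleinTransform t * (1 - t / 2 + t ^ 2 / 8 - t ^ 3 / 48) := by
  simp only [Finset.sum_range_succ, Finset.sum_range_zero, kleinTruncCoeff,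
    List.getD_cons_zero, List.getD_cons_succ, kleinTransform]
  ring

theorem sum_kleinCoeff_mul_evenHermite (w : ℝ) :
    ∑ k ∈ Finset.range 14, kleinCoeff k * evenHermite w k = kleinTransform (-w) := by
  simp only [Finset.sum_range_succ, Finset.sum_range_zero, kleinCoeff,
    List.getD_cons_zero, List.getD_cons_succ, kleinTransform, evenHermite]
  push_cast
  ring

theorem evenFT_klein (ξ : ℝ) : evenFT (gaussPoly (polyOfCoeffs 14 kleinCoeff)) ξ =
    kleinTransform (ξ ^ 2) * rexp (-ξ ^ 2 / 2) := by
  rw [evenFT_gaussPoly, sum_kleinCoeff_mul_evenHermite, neg_neg]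

theorem integral_klein_mul_cosh :
    (1 / Real.sqrt (2 * π)) *
      ∫ x : ℝ, gaussPoly (polyOfCoeffs 14 kleinCoeff) x * Real.cosh (x / 2) =
      kleinTransform (-(1 / 4)) * rexp (1 / 8) := by
  have h := integral_gaussPoly_mul_cosh 14 kleinCoeff (1 / 2)
  rw [sum_kleinCoeff_mul_evenHermite] at h
  convert! h using 3
  · funext x
    rw [div_eq_mul_one_div, mul_comm x]
  · norm_num
  · norm_num

theorem kleinTransform_nonneg {t : ℝ} (ht : 0 ≤ t) : 0 ≤ kleinTransform t := by
  unfold kleinTransform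
  positivity

theorem kleinTransform_le_of_le {s t : ℝ} (hs : 9 / 20 ≤ s) (hst : s ≤ t)
    (ht : t ≤ 3) : kleinTransform t ≤ kleinTransform s := by
  have h (r : ℝ) (hr : 3 ≤ r) : (r - t) ^ 2 ≤ (r - s) ^ 2 :=
    pow_le_pow_left₀ (by linarith) (by linarith) 2
  have h3 : (3 - t) ^ 2 * (500 * t + 451) ≤ (3 - s) ^ 2 * (500 * s + 451) := by
    nlinarith [mul_nonneg (sub_nonneg.2 hst) (sub_nonneg.2 hs),
      mul_nonneg (sub_nonneg.2 hst) (sub_nonneg.2 ht),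
      mul_nonneg (mul_nonneg (sub_nonneg.2 hst) (sub_nonneg.2 hs)) (sub_nonneg.2 ht),
      mul_nonneg (mul_nonneg (sub_nonneg.2 hst) (sub_nonneg.2 ht)) (sub_nonneg.2 ht),
      mul_nonneg (mul_nonneg (sub_nonneg.2 hst) (sub_nonneg.2 hst)) (sub_nonneg.2 ht),
      mul_nonneg (mul_nonneg (sub_nonneg.2 hst) (sub_nonneg.2 hst)) (sub_nonneg.2 hs)]
  have e (t : ℝ) : kleinTransform t = (3 - t) ^ 2 * (500 * t + 451) * ((7 - t) ^ 2 *
      (12 - t) ^ 2 * (21 - t) ^ 2 * (32 - t) ^ 2 * (53 - t) ^ 2) := by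
    unfold kleinTransform
    ring
  have h7 := h 7 (by norm_num)
  have h12 := h 12 (by norm_num)
  have h21 := h 21 (by norm_num)
  have h32 := h 32 (by norm_num)
  have h53 := h 53 (by norm_num)
  have h0 : 0 ≤ 500 * s + 451 := by linarith
  rw [e, e]
  gcongr

theorem eval_kleinCoeff_nonpos {t : ℝ} (ht : 15.4912 ≤ t) :
    (polyOfCoeffs 14 kleinCoeff).eval t ≤ 0 := by
  obtain ⟨s, hs, rfl⟩ : ∃ s, 0 ≤ s ∧ t = 15.4912 + s := ⟨t - 15.4912, by linarith, by ring⟩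
  rw [eval_polyOfCoeffs]
  simp only [Finset.sum_range_succ, Finset.sum_range_zero, kleinCoeff,
    List.getD_cons_zero, List.getD_cons_succ]
  rw [← neg_nonneg]
  ring_nf
  positivity

theorem eval_kleinCoeff_le {t : ℝ} (ht : 27.12 ≤ t) :
    (polyOfCoeffs 14 kleinCoeff).eval t ≤ -(608 * 10 ^ 18) := by
  obtain ⟨s, hs, rfl⟩ : ∃ s, 0 ≤ s ∧ t = 27.12 + s := ⟨t - 27.12, by linarith, by ring⟩
  rw [eval_polyOfCoeffs]
  simp only [Finset.sum_range_succ, Finset.sum_range_zero, kleinCoeff,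
    List.getD_cons_zero, List.getD_cons_succ]
  rw [← sub_nonneg]
  ring_nf
  positivity

theorem exp_neg_le_quadratic {y : ℝ} (hy : 0 ≤ y) : rexp (-y) ≤ 1 - y + y ^ 2 / 2 := by
  have hd (x : ℝ) : HasDerivAt (fun x : ℝ ↦ 1 - x + x ^ 2 / 2 - rexp (-x))
      (x - 1 + rexp (-x)) x := by
    convert! ((((hasDerivAt_id x).const_sub 1).add ((hasDerivAt_pow 2 x).div_const 2)).sub
      (hasDerivAt_neg x).exp) using 1
    push_cast
    ring
  have hm := monotone_of_hasDerivAt_nonneg hd fun x ↦ by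
    simp only [Pi.zero_apply]
    linarith [Real.add_one_le_exp (-x)]
  have := hm hy
  simp only [neg_zero, Real.exp_zero] at this
  linarith

theorem cubic_le_exp_neg {y : ℝ} (hy : 0 ≤ y) :
    1 - y + y ^ 2 / 2 - y ^ 3 / 6 ≤ rexp (-y) := by
  have hd (x : ℝ) : HasDerivAt (fun x : ℝ ↦ rexp (-x) - (1 - x + x ^ 2 / 2 - x ^ 3 / 6))
      (1 - x + x ^ 2 / 2 - rexp (-x)) x := by
    convert! (hasDerivAt_neg x).exp.sub ((((hasDerivAt_id x).const_sub 1).add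
      ((hasDerivAt_pow 2 x).div_const 2)).sub ((hasDerivAt_pow 3 x).div_const 6)) using 1
    push_cast
    ring
  have hm : MonotoneOn (fun x : ℝ ↦ rexp (-x) - (1 - x + x ^ 2 / 2 - x ^ 3 / 6)) (Set.Ici 0) :=
    monotoneOn_of_hasDerivWithinAt_nonneg (convex_Ici 0) (by fun_prop)
      (fun x _ ↦ (hd x).hasDerivWithinAt) fun x hx ↦ by
        rw [interior_Ici] at hx
        linarith [exp_neg_le_quadratic (le_of_lt hx)]
  have := hm (Set.mem_Ici.2 le_rfl) hy hy
  simp only [neg_zero, Real.exp_zero] at this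
  linarith

theorem integral_klein_mul_tanh_le :
    ∫ x in Set.Ioi (0 : ℝ), x * evenFT (gaussPoly (polyOfCoeffs 14 kleinCoeff)) x *
      Real.tanh (π * x) ≤ 124942 * 10 ^ 11 := by
  have h := sum_mul_tanh_integral_le 14 17 kleinTransformCoeff kleinTruncCoeff fun t ht ↦ by
    rw [sum_kleinTruncCoeff, sum_kleinTransformCoeff]
    refine mul_le_mul_of_nonneg_left ?_ (kleinTransform_nonneg ht)
    convert! cubic_le_exp_neg (by positivity : 0 ≤ t / 2) using 1
    · ring
    · rw [neg_div]
  simp_rw [sum_kleinTransformCoeff, ← evenFT_klein] at h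
  refine h.trans ?_
  obtain ⟨b2, b4, b6, b8, b10, b12, b14, b16, b18, b20, b22, b24, b26, b28, b30, b32, b34⟩ :=
    bernoulli_two_mul_values
  norm_num [Finset.sum_range_succ, kleinTransformCoeff, kleinTruncCoeff, Nat.factorial,
    b2, b4, b6, b8, b10, b12, b14, b16, b18, b20, b22, b24, b26, b28, b30, b32, b34]

theorem cos_two_pi_div_seven_cubic : 1 / 2 < Real.cos (2 * π / 7) ∧
    8 * Real.cos (2 * π / 7) ^ 3 + 4 * Real.cos (2 * π / 7) ^ 2 - 4 * Real.cos (2 * π / 7) - 1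
      = 0 := by
  have hpi := Real.pi_pos
  have hlo : 1 / 2 < Real.cos (2 * π / 7) := by
    rw [← Real.cos_pi_div_three]
    exact Real.cos_lt_cos_of_nonneg_of_le_pi (by positivity) (by linarith) (by linarith)
  have hlt : Real.cos (2 * π / 7) < 1 := by
    rw [← Real.cos_zero]
    exact Real.cos_lt_cos_of_nonneg_of_le_pi le_rfl (by linarith) (by positivity)
  have h4 : Real.cos (2 * (2 * (2 * π / 7))) = Real.cos (3 * (2 * π / 7)) := by
    rw [show 2 * (2 * (2 * π / 7)) = 2 * π - 3 * (2 * π / 7) by ring, Real.cos_two_pi_sub]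
  rw [Real.cos_two_mul, Real.cos_two_mul, Real.cos_three_mul] at h4
  refine ⟨hlo, (mul_eq_zero.1 ?_).resolve_left (sub_ne_zero.2 hlt.ne)⟩
  linear_combination h4

theorem cos_two_pi_div_seven_mem :
    Real.cos (2 * π / 7) ∈ Set.Icc (0.623489 : ℝ) 0.62349 := by
  obtain ⟨hlo, h⟩ := cos_two_pi_div_seven_cubic
  constructor <;> by_contra! hx <;>
    nlinarith [mul_pos (sub_pos.2 hlo) (sub_pos.2 hlo), mul_pos (sub_pos.2 hlo) (sub_pos.2 hx),
      mul_pos (mul_pos (sub_pos.2 hlo) (sub_pos.2 hlo)) (sub_pos.2 hx)]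

theorem arccosh_mem_Icc {y a b lo hi : ℝ} (hy : 1 ≤ y)
    (hya : a ^ 2 + 1 ≤ 2 * a * y) (hyb : 2 * b * y ≤ b ^ 2 + 1) (hb : y ≤ b)
    (hlo : rexp lo ≤ a) (hhi : b ≤ rexp hi) : Real.arccosh y ∈ Set.Icc lo hi := by
  have hs := Real.sqrt_nonneg (y ^ 2 - 1)
  have ha' : a - y ≤ Real.sqrt (y ^ 2 - 1) := Real.le_sqrt_of_sq_le (by nlinarith)
  have hb' : Real.sqrt (y ^ 2 - 1) ≤ b - y := Real.sqrt_le_iff.2 ⟨by linarith, by nlinarith⟩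
  have hpos : 0 < y + Real.sqrt (y ^ 2 - 1) := by linarith
  exact ⟨(Real.le_log_iff_exp_le hpos).2 (by linarith),
    (Real.log_le_iff_le_exp hpos).2 (by linarith)⟩

theorem exp_le_taylor {x : ℝ} (h0 : 0 ≤ x) (h1 : x ≤ 1) :
    rexp x ≤ 1 + x + x ^ 2 / 2 + x ^ 3 / 6 + x ^ 4 / 24 + x ^ 5 / 120 + x ^ 6 / 720 +
      x ^ 7 / 5040 + x ^ 8 / 40320 + x ^ 9 / 362880 + x ^ 10 / 3000000 := by
  have h := Real.exp_bound' h0 h1 (n := 10) (by norm_num)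
  norm_num [Finset.sum_range_succ, Nat.factorial] at h
  have : 0 ≤ x ^ 10 := by positivity
  linarith

theorem taylor_le_exp {x : ℝ} (h0 : 0 ≤ x) :
    1 + x + x ^ 2 / 2 + x ^ 3 / 6 + x ^ 4 / 24 + x ^ 5 / 120 + x ^ 6 / 720 +
      x ^ 7 / 5040 + x ^ 8 / 40320 + x ^ 9 / 362880 ≤ rexp x := by
  have h := Real.sum_le_exp_of_nonneg h0 10
  norm_num [Finset.sum_range_succ, Nat.factorial] at h
  linarith

theorem klein_systole_ge : (3.9359 : ℝ) ≤ 8 * Real.arccosh (1 / 2 + Real.cos (2 * π / 7)) := by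
  obtain ⟨hlo, hhi⟩ := cos_two_pi_div_seven_mem
  have h1 : rexp (3.9359 / 8) ≤ 1.63557 :=
    (exp_le_taylor (by norm_num) (by norm_num)).trans (by norm_num)
  have h2 : (1.6356 : ℝ) ≤ rexp 0.5 :=
    le_trans (by norm_num) (taylor_le_exp (by norm_num))
  have := (arccosh_mem_Icc (a := 1.63557) (b := 1.6356)
    (by linarith : 1 ≤ 1 / 2 + Real.cos (2 * π / 7)) (by linarith) (by linarith) (by linarith)
    h1 h2).1
  linarith

theorem klein_second_length_mem :
    6 * Real.arccosh (8 * Real.cos (π / 7) ^ 4 - 6 * Real.cos (π / 7) ^ 2 + 1) ∈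
      Set.Icc (5.2079 : ℝ) 5.2081 := by
  obtain ⟨hlo, hhi⟩ := cos_two_pi_div_seven_mem
  have hy : 8 * Real.cos (π / 7) ^ 4 - 6 * Real.cos (π / 7) ^ 2 + 1 =
      2 * Real.cos (2 * π / 7) ^ 2 + Real.cos (2 * π / 7) := by
    rw [show 2 * π / 7 = 2 * (π / 7) by ring, Real.cos_two_mul]
    ring
  rw [hy]
  set x := Real.cos (2 * π / 7)
  have h1 : rexp (5.2079 / 6) ≤ 2.38213 :=
    (exp_le_taylor (by norm_num) (by norm_num)).trans (by norm_num)
  have h2 : (2.382155 : ℝ) ≤ rexp (5.2081 / 6) :=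
    le_trans (by norm_num) (taylor_le_exp (by norm_num))
  have h := arccosh_mem_Icc (y := 2 * x ^ 2 + x) (a := 2.38213) (b := 2.382155)
    (by nlinarith) (by nlinarith) (by nlinarith) (by nlinarith) h1 h2
  exact ⟨by linarith [h.1], by linarith [h.2]⟩

theorem sinh_le_of_le {x : ℝ} (hx : x ≤ 5.2081 / 2) : Real.sinh x ≤ 6.7226 := by
  have h1 : rexp (5.2081 / 6) ≤ 2.38219 :=
    (exp_le_taylor (by norm_num) (by norm_num)).trans (by norm_num)
  have h3 : rexp (5.2081 / 2) ≤ 13.5186 := by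
    rw [show (5.2081 / 2 : ℝ) = (3 : ℕ) * (5.2081 / 6) by norm_num, Real.exp_nat_mul]
    exact (pow_le_pow_left₀ (Real.exp_nonneg _) h1 3).trans (by norm_num)
  have h4 : (13.5186 : ℝ)⁻¹ ≤ rexp (-(5.2081 / 2)) := by
    rw [Real.exp_neg]
    exact inv_anti₀ (Real.exp_pos _) h3
  calc Real.sinh x ≤ Real.sinh (5.2081 / 2) := Real.sinh_le_sinh.2 hx
    _ ≤ _ := by
      rw [Real.sinh_eq]
      norm_num at h4 ⊢
      linarith

theorem klein_second_term_le {L : ℝ} (hlo : 5.2079 ≤ L) (hhi : L ≤ 5.2081) :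
    (1 / Real.sqrt (2 * π)) * (28 * L * gaussPoly (polyOfCoeffs 14 kleinCoeff) L /
      Real.sinh (L / 2)) ≤ -(6770 * 10 ^ 12) := by
  have hsqrt : Real.sqrt (2 * π) ≤ 2.50663 :=
    Real.sqrt_le_iff.2 ⟨by norm_num, by linarith [Real.pi_lt_d6]⟩
  have hsqrt0 : 0 < Real.sqrt (2 * π) := by positivity
  have hsinh := sinh_le_of_le (x := L / 2) (by linarith)
  have hsinh0 : 0 < Real.sinh (L / 2) := Real.sinh_pos_iff.2 (by linarith)
  have hexp : (776400 : ℝ)⁻¹ ≤ rexp (-L ^ 2 / 2) := by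
    have h1 : rexp (13.56216 / 16) ≤ 2.334122 :=
      (exp_le_taylor (by norm_num) (by norm_num)).trans (by norm_num)
    have h2 : rexp 13.56216 ≤ 776400 := by
      rw [show (13.56216 : ℝ) = (16 : ℕ) * (13.56216 / 16) by norm_num, Real.exp_nat_mul]
      exact (pow_le_pow_left₀ (Real.exp_nonneg _) h1 16).trans (by norm_num)
    refine (inv_anti₀ (Real.exp_pos _) h2).trans ?_
    rw [← Real.exp_neg, Real.exp_le_exp]
    nlinarith
  have hu := eval_kleinCoeff_le (t := L ^ 2) (by nlinarith)
  have key : 608 * 10 ^ 18 * (776400 : ℝ)⁻¹ ≤ -gaussPoly (polyOfCoeffs 14 kleinCoeff) L := by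
    rw [gaussPoly, ← neg_mul]
    exact mul_le_mul (by linarith) hexp (by positivity) (by linarith)
  have : 6770 * 10 ^ 12 ≤ 28 * L * -gaussPoly (polyOfCoeffs 14 kleinCoeff) L /
      (Real.sqrt (2 * π) * Real.sinh (L / 2)) := by
    rw [le_div_iff₀ (by positivity)]
    calc _ ≤ (6770 * 10 ^ 12 : ℝ) * (2.50663 * 6.7226) := by gcongr
      _ ≤ 28 * 5.2079 * (608 * 10 ^ 18 * (776400 : ℝ)⁻¹) := by norm_num
      _ ≤ _ := by gcongr
  rw [← neg_le_neg_iff, neg_neg]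
  refine this.trans_eq ?_
  field_simp

theorem klein_lower_value_gt :
    (3709 * 10 ^ 11 : ℝ) < kleinTransform 2.325 * rexp (-2.325 / 2) := by
  have h1 : rexp (2.325 / 4) ≤ 1.788273 :=
    (exp_le_taylor (by norm_num) (by norm_num)).trans (by norm_num)
  have h2 : rexp (2.325 / 2) ≤ 3.19793 := by
    rw [show (2.325 / 2 : ℝ) = (2 : ℕ) * (2.325 / 4) by norm_num, Real.exp_nat_mul]
    exact (pow_le_pow_left₀ (Real.exp_nonneg _) h1 2).trans (by norm_num)
  have h3 : (3.19793 : ℝ)⁻¹ ≤ rexp (-2.325 / 2) := by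
    rw [neg_div, Real.exp_neg]
    exact inv_anti₀ (Real.exp_pos _) h2
  calc (3709 * 10 ^ 11 : ℝ) < kleinTransform 2.325 * (3.19793 : ℝ)⁻¹ := by
        norm_num [kleinTransform]
    _ ≤ _ := mul_le_mul_of_nonneg_left h3 (kleinTransform_nonneg (by norm_num))

theorem klein_cosh_term_ge : (40985 * 10 ^ 12 : ℝ) ≤ kleinTransform (-(1 / 4)) * rexp (1 / 8) := by
  have h : (1.13314 : ℝ) ≤ rexp (1 / 8) := le_trans (by norm_num) (taylor_le_exp (by norm_num))
  calc (40985 * 10 ^ 12 : ℝ) ≤ kleinTransform (-(1 / 4)) * 1.13314 := by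
        norm_num [kleinTransform]
    _ ≤ _ := mul_le_mul_of_nonneg_left h (by norm_num [kleinTransform])

theorem stmt_3 :
    ∃ (u : Polynomial ℝ) (c : ℝ), 0 < c ∧
      (let f : ℝ → ℝ := gaussPoly u
      let fhat : ℝ → ℝ := evenFT f
      let L₁ : ℝ := 8 * Real.arccosh (1 / 2 + Real.cos (2 * π / 7))
      let L₂ : ℝ := 6 * Real.arccosh (8 * Real.cos (π / 7) ^ 4 - 6 * Real.cos (π / 7) ^ 2 + 1)
      (∀ x : ℝ, (3.9359 : ℝ) ≤ x → f x ≤ 0) ∧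
      (∀ lam : ℝ, lam ∈ Set.Icc (0.71 : ℝ) 2.575 → fhat (Real.sqrt (lam - 1 / 4)) ≥ c) ∧
      (∀ lam : ℝ, (2.575 : ℝ) ≤ lam → fhat (Real.sqrt (lam - 1 / 4)) ≥ 0) ∧
      (1 / c) *
          (4 * (∫ ξ in Set.Ioi (0 : ℝ), ξ * fhat ξ * Real.tanh (π * ξ))
            + (1 / Real.sqrt (2 * π)) * (21 * L₁ * f L₁ / Real.sinh (L₁ / 2) + 28 * L₂ * f L₂ / Real.sinh (L₂ / 2))
            - (1 / Real.sqrt (2 * π)) * ∫ x : ℝ, f x * Real.cosh (x / 2)) < 6) := by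
  have hf (x : ℝ) (hx : 3.9359 ≤ x) : gaussPoly (polyOfCoeffs 14 kleinCoeff) x ≤ 0 :=
    mul_nonpos_of_nonpos_of_nonneg (eval_kleinCoeff_nonpos (by nlinarith)) (Real.exp_nonneg _)
  have hc := klein_lower_value_gt
  have hc0 : 0 < kleinTransform 2.325 * rexp (-2.325 / 2) := lt_trans (by norm_num) hc
  refine ⟨polyOfCoeffs 14 kleinCoeff, kleinTransform 2.325 * rexp (-2.325 / 2), hc0, hf,
    ?_, ?_, ?_⟩
  · rintro lam ⟨h1, h2⟩
    rw [ge_iff_le, evenFT_klein, Real.sq_sqrt (by linarith)]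
    exact mul_le_mul (kleinTransform_le_of_le (by linarith) (by linarith) (by norm_num))
      (Real.exp_le_exp.2 (by linarith)) (Real.exp_nonneg _)
      (kleinTransform_nonneg (by linarith))
  · intro lam h
    rw [ge_iff_le, evenFT_klein]
    exact mul_nonneg (kleinTransform_nonneg (sq_nonneg _)) (Real.exp_nonneg _)
  · have hT := integral_klein_mul_tanh_le
    have hC := klein_cosh_term_ge
    have h1 := klein_systole_ge
    have h2 := klein_second_length_mem
    set L₁ := 8 * Real.arccosh (1 / 2 + Real.cos (2 * π / 7))
    set L₂ := 6 * Real.arccosh (8 * Real.cos (π / 7) ^ 4 - 6 * Real.cos (π / 7) ^ 2 + 1)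
    have hL₂ := klein_second_term_le h2.1 h2.2
    have hL₁ : (1 / Real.sqrt (2 * π)) *
        (21 * L₁ * gaussPoly (polyOfCoeffs 14 kleinCoeff) L₁ / Real.sinh (L₁ / 2)) ≤ 0 := by
      have hs : 0 < Real.sinh (L₁ / 2) := Real.sinh_pos_iff.2 (by linarith)
      exact mul_nonpos_of_nonneg_of_nonpos (by positivity) (div_nonpos_of_nonpos_of_nonneg
        (mul_nonpos_of_nonneg_of_nonpos (by linarith) (hf _ h1)) hs.le)
    rw [integral_klein_mul_cosh, mul_add, one_div, inv_mul_lt_iff₀ hc0]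
    linarith
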